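/- arXiv:1804.02339 — 3 statements merged into one kernel-verified Lean document; each statement's English description precedes it below -/
import Mathlib

section
/- (Key recursive inequality, Variant 1.) Let f, g, h : ℝ^p → ℝ be convex, with f differentiable, L_f-smooth and μ_f-strongly convex for some μ_f ≥ 0, and suppose h* − (μ_h/2)‖·‖² is convex (as an ℝ ∪ {+∞}-valued function) for some μ_h ≥ 0. Let τ ∈ (0,1), γ_0 > 0, and let (γ_t)_{t≥0}, (x_t), (z_t), (u_t) be adaptive three-operator-splitting iterates with δ_t ≥ 0 for all t, satisfying min{γ_0, τ/L_f} ≤ γ_t ≤ γ_{t−1} for every t ≥ 0 (with γ_{−1} = γ_0). Set ρ := μ_f · min{γ_0, τ/L_f} and L(x,u) := f(x) + g(x) + ⟨x,u⟩ − h*(u). Then for every t ≥ 0 and every x, u ∈ ℝ^p with h*(u) < +∞: 2γ_t (L(x_{t+1}, u) − L(x, u_{t+1})) + ‖z_{t+1} − x‖² + (1 + μ_h/γ_0) γ_t² ‖u_{t+1} − u‖² ≤ (1 − ρ)‖z_t − x‖² + γ_{t−1}² ‖u_t − u‖². -/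
open scoped RealInnerProductSpace

/-- `z` is the proximal point `prox_{γ φ}(x)`. -/
def IsProx {p : ℕ} (φ : EuclideanSpace ℝ (Fin p) → ℝ) (γ : ℝ)
    (x z : EuclideanSpace ℝ (Fin p)) : Prop :=
  ∀ y, φ z + ‖x - z‖ ^ 2 / (2 * γ) ≤ φ y + ‖x - y‖ ^ 2 / (2 * γ)

/-- The Fenchel conjugate `φ*(u) = sup_x (⟨x, u⟩ - φ(x))`, valued in `ℝ ∪ {+∞}`
(modelled by `EReal`). -/
noncomputable def fenchel {p : ℕ} (φ : EuclideanSpace ℝ (Fin p) → ℝ)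
    (u : EuclideanSpace ℝ (Fin p)) : EReal :=
  ⨆ x, ((⟪x, u⟫ - φ x : ℝ) : EReal)

/-- The saddle-point Lagrangian `L(x, u) = f(x) + g(x) + ⟨x, u⟩ - h*(u)`
(its real value, meaningful whenever `h*(u) < +∞`). -/
noncomputable def saddleL {p : ℕ} (f g h : EuclideanSpace ℝ (Fin p) → ℝ)
    (x u : EuclideanSpace ℝ (Fin p)) : ℝ :=
  f x + g x + ⟪x, u⟫ - (fenchel h u).toReal

lemma aux_lim (A B : ℝ) (h : ∀ s : ℝ, 0 < s → s ≤ 1 → A ≤ s * B) : A ≤ 0 := by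
  by_contra hA
  push Not at hA
  have h1 := h 1 one_pos le_rfl
  have hB : 0 < B := by linarith
  have h2 := h (A / (2 * B)) (by positivity) (by
    rw [div_le_one (by positivity)]; linarith)
  have : A / (2 * B) * B = A / 2 := by field_simp
  linarith

lemma aux_norm {E : Type*} [NormedAddCommGroup E] [InnerProductSpace ℝ E] (a b : E) (s : ℝ) :
    ‖a + s • b‖ ^ 2 = ‖a‖ ^ 2 + 2 * s * ⟪a, b⟫ + s ^ 2 * ‖b‖ ^ 2 := by
  rw [norm_add_sq_real, inner_smul_right, norm_smul, mul_pow, Real.norm_eq_abs, sq_abs]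
  ring

lemma aux_strong {E : Type*} [NormedAddCommGroup E] [InnerProductSpace ℝ E] (S : Set E)
    (ψ : E → ℝ) (μ : ℝ) (hc : ConvexOn ℝ S (fun w => ψ w - μ / 2 * ‖w‖ ^ 2))
    (a v : E) (ha : a ∈ S) (hsub : ∀ w ∈ S, ψ a + ⟪v, w - a⟫ ≤ ψ w) (b : E) (hb : b ∈ S) :
    ψ a + ⟪v, b - a⟫ + μ / 2 * ‖b - a‖ ^ 2 ≤ ψ b := by
  have key := aux_lim (ψ a + ⟪v, b - a⟫ + μ / 2 * ‖b - a‖ ^ 2 - ψ b) (μ / 2 * ‖b - a‖ ^ 2) (by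
    intro s hs hs1
    have h1 := hc.2 ha hb (sub_nonneg.2 hs1) hs.le (by ring)
    have hmem := hc.1 ha hb (sub_nonneg.2 hs1) hs.le (by ring)
    have h2 := hsub _ hmem
    have e : (1 - s) • a + s • b = a + s • (b - a) := by module
    rw [e] at h1 h2
    have e2 : a + s • (b - a) - a = s • (b - a) := by module
    rw [e2, inner_smul_right] at h2
    have e3 : ‖b‖ ^ 2 = ‖a‖ ^ 2 + 2 * ⟪a, b - a⟫ + ‖b - a‖ ^ 2 := by
      have := aux_norm a (b - a) 1
      simp only [one_smul, add_sub_cancel] at this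
      rw [this]; ring
    simp only [smul_eq_mul] at h1
    rw [aux_norm, e3] at h1
    refine le_of_mul_le_mul_left ?_ hs
    linear_combination h1 + h2)
  linarith

lemma aux_grad {p : ℕ} (f : EuclideanSpace ℝ (Fin p) → ℝ) (v a : EuclideanSpace ℝ (Fin p))
    (hf : ConvexOn ℝ Set.univ f) (hd : HasGradientAt f v a) (b : EuclideanSpace ℝ (Fin p)) :
    f a + ⟪v, b - a⟫ ≤ f b := by
  have hc : ConvexOn ℝ Set.univ (fun s : ℝ => f (a + s • (b - a))) := by
    refine ⟨convex_univ, ?_⟩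
    intro s _ r _ c d hc hd hcd
    have := hf.2 (Set.mem_univ (a + s • (b - a))) (Set.mem_univ (a + r • (b - a))) hc hd hcd
    convert this using 2
    have : d = 1 - c := by linarith
    subst this
    simp only [smul_eq_mul]
    module
  have hd2 : HasDerivAt (fun s : ℝ => f (a + s • (b - a))) ⟪v, b - a⟫ 0 := by
    have h1 : HasDerivAt (fun s : ℝ => a + s • (b - a)) (b - a) 0 := by
      simpa using ((hasDerivAt_id (0 : ℝ)).smul_const (b - a)).const_add a
    have h2 : HasFDerivAt f (InnerProductSpace.toDual ℝ _ v) (a + (0 : ℝ) • (b - a)) := by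
      simpa using hd.hasFDerivAt
    have h3 := h2.comp_hasDerivAt (0 : ℝ) h1
    rw [InnerProductSpace.toDual_apply_apply] at h3
    exact h3
  have := hc.le_slope_of_hasDerivAt (Set.mem_univ (0 : ℝ)) (Set.mem_univ 1) one_pos hd2
  simp [slope_def_field] at this
  linarith

lemma aux_prox {p : ℕ} (φ : EuclideanSpace ℝ (Fin p) → ℝ) (γ : ℝ) (hγ : 0 < γ)
    (hφ : ConvexOn ℝ Set.univ φ) (x z : EuclideanSpace ℝ (Fin p)) (h : IsProx φ γ x z)
    (y : EuclideanSpace ℝ (Fin p)) : φ z + ⟪γ⁻¹ • (x - z), y - z⟫ ≤ φ y := by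
  have key := aux_lim (φ z + γ⁻¹ * ⟪x - z, y - z⟫ - φ y) (‖y - z‖ ^ 2 / (2 * γ)) (by
    intro s hs hs1
    have h1 := hφ.2 (Set.mem_univ z) (Set.mem_univ y) (sub_nonneg.2 hs1) hs.le (by ring)
    have h2 := h ((1 - s) • z + s • y)
    have e : x - ((1 - s) • z + s • y) = (x - z) + (-s) • (y - z) := by module
    rw [e, aux_norm] at h2
    simp only [smul_eq_mul] at h1
    refine le_of_mul_le_mul_left ?_ hs
    have e3 : (‖x - z‖ ^ 2 + 2 * -s * ⟪x - z, y - z⟫ + (-s) ^ 2 * ‖y - z‖ ^ 2) / (2 * γ)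
      = ‖x - z‖ ^ 2 / (2 * γ) - s * (γ⁻¹ * ⟪x - z, y - z⟫) + s * (s * (‖y - z‖ ^ 2 / (2 * γ))) := by
      field_simp
      ring
    rw [e3] at h2
    linear_combination h1 + h2)
  rw [real_inner_smul_left]
  linarith

lemma aux_fenchel_le {p : ℕ} (h : EuclideanSpace ℝ (Fin p) → ℝ)
    (v y : EuclideanSpace ℝ (Fin p)) (hv : fenchel h v < ⊤) :
    ⟪y, v⟫ - h y ≤ (fenchel h v).toReal := by
  have h1 : ((⟪y, v⟫ - h y : ℝ) : EReal) ≤ fenchel h v :=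
    le_iSup (fun x => ((⟪x, v⟫ - h x : ℝ) : EReal)) y
  have := EReal.toReal_le_toReal h1 (EReal.coe_ne_bot _) hv.ne
  simpa only [EReal.toReal_coe] using this

lemma aux_fenchel_eq {p : ℕ} (h : EuclideanSpace ℝ (Fin p) → ℝ)
    (v z : EuclideanSpace ℝ (Fin p)) (hs : ∀ y, h z + ⟪v, y - z⟫ ≤ h y) :
    fenchel h v = ((⟪z, v⟫ - h z : ℝ) : EReal) := by
  refine le_antisymm (iSup_le fun y => ?_)
    (le_iSup (fun x => ((⟪x, v⟫ - h x : ℝ) : EReal)) z)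
  have := hs y
  rw [inner_sub_right, real_inner_comm, real_inner_comm z v] at this
  exact EReal.coe_le_coe_iff.2 (by linarith)

/-- **Key recursive inequality, Variant 1** for the adaptive three operator
splitting iterates (here `γ (t-1)` for `t = 0` is `γ 0` thanks to truncated
subtraction, implementing the convention `γ₋₁ = γ₀`). -/
theorem key_recursive_inequality_variant1 {p : ℕ}
    (f g h : EuclideanSpace ℝ (Fin p) → ℝ)
    (f' : EuclideanSpace ℝ (Fin p) → EuclideanSpace ℝ (Fin p))
    (L_f μ_f μ_h τ : ℝ)
    (hf : ConvexOn ℝ Set.univ f) (hg : ConvexOn ℝ Set.univ g)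
    (hh : ConvexOn ℝ Set.univ h)
    (hf' : ∀ w, HasGradientAt f (f' w) w)
    (hsmooth : ∀ a b, ‖f' a - f' b‖ ≤ L_f * ‖a - b‖)
    (hμf : 0 ≤ μ_f)
    (hfsc : ConvexOn ℝ Set.univ (fun w => f w - μ_f / 2 * ‖w‖ ^ 2))
    (hμh : 0 ≤ μ_h)
    (hconjsc : ConvexOn ℝ {v : EuclideanSpace ℝ (Fin p) | fenchel h v < ⊤}
      (fun v => (fenchel h v).toReal - μ_h / 2 * ‖v‖ ^ 2))
    (hτ : τ ∈ Set.Ioo (0 : ℝ) 1)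
    (γ : ℕ → ℝ) (x z u : ℕ → EuclideanSpace ℝ (Fin p)) (δ : ℕ → ℝ)
    (hγpos : ∀ t, 0 < γ t)
    (hx : ∀ t, IsProx g (γ t) (z t - γ t • u t - γ t • f' (z t)) (x (t + 1)))
    (hz : ∀ t, IsProx h (γ t) (x (t + 1) + γ t • u t) (z (t + 1)))
    (hu : ∀ t, u (t + 1) = u t + (γ t)⁻¹ • (x (t + 1) - z (t + 1)))
    (hδ : ∀ t, δ t = f (z t) + ⟪f' (z t), x (t + 1) - z t⟫ +
      ‖x (t + 1) - z t‖ ^ 2 / (2 * γ t) - f (x (t + 1)))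
    (hδpos : ∀ t, 0 ≤ δ t)
    (hlb : ∀ t, min (γ 0) (τ / L_f) ≤ γ t)
    (hmono : ∀ t, γ (t + 1) ≤ γ t) :
    ∀ (t : ℕ) (xx uu : EuclideanSpace ℝ (Fin p)), fenchel h uu < ⊤ →
      2 * γ t * (saddleL f g h (x (t + 1)) uu - saddleL f g h xx (u (t + 1))) +
          ‖z (t + 1) - xx‖ ^ 2 +
          (1 + μ_h / γ 0) * (γ t) ^ 2 * ‖u (t + 1) - uu‖ ^ 2 ≤
        (1 - μ_f * min (γ 0) (τ / L_f)) * ‖z t - xx‖ ^ 2 +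
          (γ (t - 1)) ^ 2 * ‖u t - uu‖ ^ 2 := by
  intro t xx uu huu
  have hg0 := hγpos t
  have hg00 := hγpos 0
  have hanti : Antitone γ := antitone_nat_of_succ_le hmono
  have hG := aux_prox g (γ t) hg0 hg _ _ (hx t) xx
  have hH := aux_prox h (γ t) hg0 hh _ _ (hz t)
  have eu : (γ t)⁻¹ • (x (t + 1) + γ t • u t - z (t + 1)) = u (t + 1) := by
    rw [hu t, add_sub_right_comm, smul_add, smul_smul, inv_mul_cancel₀ hg0.ne', one_smul, add_comm]
  rw [eu] at hH
  have hfen := aux_fenchel_eq h (u (t + 1)) (z (t + 1)) hH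
  have hfr : (fenchel h (u (t + 1))).toReal = ⟪z (t + 1), u (t + 1)⟫ - h (z (t + 1)) := by
    rw [hfen, EReal.toReal_coe]
  have hC := aux_strong _ (fun v => (fenchel h v).toReal) μ_h hconjsc (u (t + 1)) (z (t + 1))
    (by change fenchel h (u (t + 1)) < ⊤; rw [hfen]; exact EReal.coe_lt_top _)
    (by
      intro w hw
      have := aux_fenchel_le h w (z (t + 1)) hw
      simp only [hfr, inner_sub_right]
      linarith) uu huu
  have hF := aux_strong _ f μ_f hfsc (z t) (f' (z t)) (Set.mem_univ _)
    (fun w _ => aux_grad f _ _ hf (hf' _) w) xx (Set.mem_univ _)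
  have hD := hδpos t
  rw [hδ t] at hD
  have ex : x (t + 1) = z (t + 1) + γ t • (u (t + 1) - u t) := by
    rw [hu t, add_sub_cancel_left, smul_smul, mul_inv_cancel₀ hg0.ne', one_smul]; module
  have hγ0 : γ t ≤ γ 0 := hanti (Nat.zero_le t)
  have hγ1 : γ t ≤ γ (t - 1) := hanti (Nat.sub_le t 1)
  have hl := hlb t
  unfold saddleL
  generalize (fenchel h (u (t + 1))).toReal = Hp at *
  generalize (fenchel h uu).toReal = Hu at *
  generalize min (γ 0) (τ / L_f) = m at *
  have i1 : m * μ_f * ‖z t - xx‖ ^ 2 ≤ γ t * μ_f * ‖z t - xx‖ ^ 2 := by gcongr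
  have i2 : (γ t) ^ 2 * ‖u t - uu‖ ^ 2 ≤ (γ (t - 1)) ^ 2 * ‖u t - uu‖ ^ 2 := by gcongr
  have i3 : μ_h / γ 0 * (γ t) ^ 2 * ‖u (t + 1) - uu‖ ^ 2 ≤ γ t * μ_h * ‖u (t + 1) - uu‖ ^ 2 := by
    refine mul_le_mul_of_nonneg_right ?_ (by positivity)
    rw [div_mul_eq_mul_div, div_le_iff₀ hg00]
    have := mul_le_mul_of_nonneg_left hγ0 (mul_nonneg hμh hg0.le)
    nlinarith [mul_le_mul_of_nonneg_left hγ0 (mul_nonneg hμh hg0.le)]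
  rw [norm_sub_rev uu] at hC
  rw [norm_sub_rev xx] at hF
  have hsum := mul_le_mul_of_nonneg_left (add_le_add (add_le_add hG hC) (add_le_add hF hD))
    (by positivity : 0 ≤ 2 * γ t)
  have e1 : 2 * γ t * (‖x (t + 1) - z t‖ ^ 2 / (2 * γ t)) = ‖x (t + 1) - z t‖ ^ 2 := by
    field_simp
  have e2 : 2 * γ t * ⟪(γ t)⁻¹ • (z t - γ t • u t - γ t • f' (z t) - x (t + 1)), xx - x (t + 1)⟫
      = 2 * ⟪z t - γ t • u t - γ t • f' (z t) - x (t + 1), xx - x (t + 1)⟫ := by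
    rw [real_inner_smul_left]; field_simp
  have e3 : 2 * ⟪z t - γ t • u t - γ t • f' (z t) - x (t + 1), xx - x (t + 1)⟫
      + 2 * γ t * ⟪z (t + 1), uu - u (t + 1)⟫ + 2 * γ t * ⟪f' (z t), xx - z t⟫
      - 2 * γ t * ⟪f' (z t), x (t + 1) - z t⟫ - ‖x (t + 1) - z t‖ ^ 2
      - 2 * γ t * (⟪x (t + 1), uu⟫ - ⟪xx, u (t + 1)⟫)
      = ‖z (t + 1) - xx‖ ^ 2 - ‖z t - xx‖ ^ 2 + (γ t) ^ 2 * ‖u (t + 1) - uu‖ ^ 2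
        - (γ t) ^ 2 * ‖u t - uu‖ ^ 2 := by
    rw [ex]
    generalize z (t + 1) = zp
    generalize u (t + 1) = up
    generalize f' (z t) = df
    generalize z t = zz
    generalize u t = u0
    simp only [← real_inner_self_eq_norm_sq, inner_sub_left, inner_sub_right, inner_add_left,
      inner_add_right, real_inner_smul_left, real_inner_smul_right]
    rw [real_inner_comm xx zz, real_inner_comm xx zp, real_inner_comm xx up, real_inner_comm xx u0,
      real_inner_comm zp zz, real_inner_comm zp up, real_inner_comm zp u0,
      real_inner_comm zz up, real_inner_comm zz u0, real_inner_comm up u0, real_inner_comm uu up,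
      real_inner_comm uu u0]
    ring
  linear_combination hsum + i1 + i2 + i3 - e3 + e1 - e2
end

section
/- (Primal part of the key inequality.) Let f : ℝ^p → ℝ be differentiable and μ_f-strongly convex for some μ_f ≥ 0, and let g, h : ℝ^p → ℝ be convex. Fix γ > 0 and z, u ∈ ℝ^p, and set x⁺ = prox_{γg}(z − γ(u + ∇f(z))), z⁺ = prox_{γh}(x⁺ + γu), u⁺ = u + (x⁺ − z⁺)/γ, and δ = f(z) + ⟨∇f(z), x⁺ − z⟩ + ‖x⁺ − z‖²/(2γ) − f(x⁺). Then for every x ∈ ℝ^p: f(x⁺) + g(x⁺) − f(x) − g(x) + ⟨x⁺ − x, u⁺⟩ ≤ ((1 − γμ_f)/(2γ))‖z − x‖² − (1/(2γ))‖z⁺ − x‖² + (1/(2γ))‖z⁺ − x⁺‖² − δ. -/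
open scoped RealInnerProductSpace

theorem prox_ineq {p : ℕ} (g : EuclideanSpace ℝ (Fin p) → ℝ) (hg : ConvexOn ℝ Set.univ g)
    (γ : ℝ) (hγ : 0 < γ) (w xp x : EuclideanSpace ℝ (Fin p)) (hxp : IsProx g γ w xp) :
    g xp + ⟪w - xp, x - xp⟫ / γ ≤ g x := by
  by_contra hcon
  push Not at hcon
  set a := g xp + ⟪w - xp, x - xp⟫ / γ - g x with ha
  have hapos : 0 < a := by linarith
  set b := ‖x - xp‖ ^ 2 / (2 * γ) with hb
  have hb0 : 0 ≤ b := by positivity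
  have key : ∀ t : ℝ, 0 < t → t ≤ 1 → a ≤ t * b := by
    intro t ht ht1
    have h1 := hxp (xp + t • (x - xp))
    have h2 := hg.2 (Set.mem_univ xp) (Set.mem_univ x) (sub_nonneg.2 ht1) ht.le (by ring)
    have e : (1 - t) • xp + t • x = xp + t • (x - xp) := by module
    rw [e] at h2
    simp only [smul_eq_mul] at h2
    have e2 : ‖w - (xp + t • (x - xp))‖ ^ 2
        = ‖w - xp‖ ^ 2 - 2 * t * ⟪w - xp, x - xp⟫ + t ^ 2 * ‖x - xp‖ ^ 2 := by
      rw [← sub_sub, norm_sub_sq_real, inner_smul_right, norm_smul, mul_pow]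
      simp only [Real.norm_eq_abs, sq_abs]
      ring
    rw [e2] at h1
    have e3 : (‖w - xp‖ ^ 2 - 2 * t * ⟪w - xp, x - xp⟫ + t ^ 2 * ‖x - xp‖ ^ 2) / (2 * γ)
        = ‖w - xp‖ ^ 2 / (2 * γ) - t * (⟪w - xp, x - xp⟫ / γ) + t * (t * b) := by
      rw [hb]; field_simp
    rw [e3] at h1
    have : t * a ≤ t * (t * b) := by rw [ha]; linarith
    exact le_of_mul_le_mul_left this ht
  have h3 := key (a / (a + b)) (by positivity) (by rw [div_le_one (by positivity)]; linarith)
  rw [div_mul_eq_mul_div, le_div_iff₀ (by positivity)] at h3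
  nlinarith

theorem grad_ineq {p : ℕ} (f : EuclideanSpace ℝ (Fin p) → ℝ) (v z x : EuclideanSpace ℝ (Fin p))
    (μ : ℝ) (hf' : HasGradientAt f v z)
    (hfsc : ConvexOn ℝ Set.univ (fun w => f w - μ / 2 * ‖w‖ ^ 2)) :
    f z + ⟪v, x - z⟫ + μ / 2 * ‖z - x‖ ^ 2 ≤ f x := by
  have hc := hfsc.comp_affineMap (AffineMap.lineMap (k := ℝ) z x)
  have hl : HasDerivAt (AffineMap.lineMap (k := ℝ) z x) (x - z) (0 : ℝ) :=
    AffineMap.hasDerivAt_lineMap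
  have h0 : (AffineMap.lineMap (k := ℝ) z x) (0 : ℝ) = z := by simp
  have hd1 : HasDerivAt (fun t : ℝ => f (AffineMap.lineMap (k := ℝ) z x t)) ⟪v, x - z⟫ 0 := by
    have h1 := hf'.hasFDerivAt
    rw [← h0] at h1
    have h2 := h1.comp_hasDerivAt (0 : ℝ) hl
    rw [InnerProductSpace.toDual_apply_apply] at h2
    exact h2
  have hd2 := hl.norm_sq
  have hd := hd1.sub (hd2.const_mul (μ / 2))
  have := hc.le_slope_of_hasDerivAt (Set.mem_univ (0 : ℝ)) (Set.mem_univ (1 : ℝ)) one_pos hd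
  simp only [slope, h0] at this
  simp at this
  simp only [inner_sub_right, real_inner_self_eq_norm_sq] at this ⊢
  rw [norm_sub_sq_real]
  linarith

/-- **Primal part of the key inequality** for one step of the adaptive three
operator splitting. -/
theorem primal_part_key_inequality {p : ℕ}
    (f g h : EuclideanSpace ℝ (Fin p) → ℝ)
    (f' : EuclideanSpace ℝ (Fin p) → EuclideanSpace ℝ (Fin p))
    (μ_f : ℝ) (hμf : 0 ≤ μ_f)
    (hf' : ∀ w, HasGradientAt f (f' w) w)
    (hfsc : ConvexOn ℝ Set.univ (fun w => f w - μ_f / 2 * ‖w‖ ^ 2))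
    (hg : ConvexOn ℝ Set.univ g) (hh : ConvexOn ℝ Set.univ h)
    (γ : ℝ) (hγ : 0 < γ) (z u xp zp up : EuclideanSpace ℝ (Fin p)) (δ : ℝ)
    (hxp : IsProx g γ (z - γ • (u + f' z)) xp)
    (hzp : IsProx h γ (xp + γ • u) zp)
    (hup : up = u + γ⁻¹ • (xp - zp))
    (hδ : δ = f z + ⟪f' z, xp - z⟫ + ‖xp - z‖ ^ 2 / (2 * γ) - f xp) :
    ∀ x : EuclideanSpace ℝ (Fin p),
      f xp + g xp - f x - g x + ⟪xp - x, up⟫ ≤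
        (1 - γ * μ_f) / (2 * γ) * ‖z - x‖ ^ 2 - 1 / (2 * γ) * ‖zp - x‖ ^ 2 +
          1 / (2 * γ) * ‖zp - xp‖ ^ 2 - δ := by
  intro x
  have h1 := prox_ineq g hg γ hγ _ _ x hxp
  have h2 := grad_ineq f (f' z) z x μ_f (hf' z) hfsc
  have e1 : ⟪z - γ • (u + f' z) - xp, x - xp⟫ / γ
      = ⟪z - xp, x - xp⟫ / γ - ⟪u, x - xp⟫ - ⟪f' z, x - xp⟫ := by
    rw [show z - γ • (u + f' z) - xp = (z - xp) - γ • (u + f' z) by abel, inner_sub_left,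
      real_inner_smul_left, inner_add_left]
    field_simp
    ring
  have e2 : ⟪xp - x, up⟫ = - ⟪u, x - xp⟫ - ⟪xp - zp, x - xp⟫ / γ := by
    rw [hup, real_inner_comm, inner_add_left, real_inner_smul_left, ← neg_sub x xp,
      inner_neg_right, inner_neg_right]
    field_simp
    ring
  have e3 : ⟪f' z, x - z⟫ = ⟪f' z, x - xp⟫ + ⟪f' z, xp - z⟫ := by
    rw [← inner_add_right]; congr 1; abel
  have e4 : ‖z - x‖ ^ 2 - ‖zp - x‖ ^ 2 + ‖zp - xp‖ ^ 2 - ‖xp - z‖ ^ 2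
      = - (2 * (⟪z - xp, x - xp⟫ + ⟪xp - zp, x - xp⟫)) := by
    rw [← inner_add_left]
    simp only [norm_sub_sq_real, inner_add_left, inner_sub_left, inner_sub_right,
      real_inner_comm z xp]
    ring
  have e5 : (1 - γ * μ_f) / (2 * γ) * ‖z - x‖ ^ 2 - 1 / (2 * γ) * ‖zp - x‖ ^ 2 +
          1 / (2 * γ) * ‖zp - xp‖ ^ 2
      = ‖xp - z‖ ^ 2 / (2 * γ) - μ_f / 2 * ‖z - x‖ ^ 2
        - ⟪z - xp, x - xp⟫ / γ - ⟪xp - zp, x - xp⟫ / γ := by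
    field_simp
    linarith
  rw [e5, e2, hδ]
  rw [e1] at h1
  linarith
end

section
/- (Dual part of the key inequality.) Let h : ℝ^p → ℝ be convex and suppose h* − (μ_h/2)‖·‖² is convex (as an ℝ ∪ {+∞}-valued function) for some μ_h ≥ 0. Fix γ > 0 and x⁺, u ∈ ℝ^p, and set z⁺ = prox_{γh}(x⁺ + γu) and u⁺ = u + (x⁺ − z⁺)/γ. Then h*(u⁺) < +∞, and for every u' ∈ ℝ^p with h*(u') < +∞: h*(u⁺) − h*(u') + ⟨x⁺, u' − u⁺⟩ ≤ (γ/2)‖u − u'‖² − (1/(2γ))‖z⁺ − x⁺‖² − ((γ + μ_h)/2)‖u⁺ − u'‖². -/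
open scoped RealInnerProductSpace

lemma limit_aux (A B : ℝ) (H : ∀ t : ℝ, 0 < t → t ≤ 1 → 0 ≤ t * A + t ^ 2 * B) : 0 ≤ A := by
  by_contra hA
  push Not at hA
  have hB : 0 < |B| + 1 := by positivity
  have hq : 0 < -A / (2 * (|B| + 1)) := div_pos (by linarith) (by positivity)
  set t := min 1 (-A / (2 * (|B| + 1))) with ht
  have ht0 : 0 < t := lt_min one_pos hq
  have h1 := H t ht0 (min_le_left _ _)
  have h2 : 0 ≤ A + t * B := by
    have : 0 ≤ t * (A + t * B) := by linarith [h1, (by ring : t * (A + t * B) = t * A + t ^ 2 * B)]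
    exact nonneg_of_mul_nonneg_right this ht0
  have h3 : t * (2 * (|B| + 1)) ≤ -A := by
    rw [← le_div_iff₀ (by positivity)]
    exact min_le_right _ _
  have h4 : t * B ≤ t * |B| := mul_le_mul_of_nonneg_left (le_abs_self B) ht0.le
  nlinarith

lemma expand_aux {p : ℕ} (a d : EuclideanSpace ℝ (Fin p)) (t : ℝ) :
    ‖a + t • d‖ ^ 2 = ‖a‖ ^ 2 + 2 * t * ⟪a, d⟫ + t ^ 2 * ‖d‖ ^ 2 := by
  rw [norm_add_sq_real, inner_smul_right, norm_smul, mul_pow, Real.norm_eq_abs, sq_abs]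
  ring

lemma prox_subgrad {p : ℕ} (h : EuclideanSpace ℝ (Fin p) → ℝ)
    (hh : ConvexOn ℝ Set.univ h) (γ : ℝ) (hγ : 0 < γ) (w z y : EuclideanSpace ℝ (Fin p))
    (hz : IsProx h γ w z) : h z + γ⁻¹ * ⟪w - z, y - z⟫ ≤ h y := by
  have key := limit_aux (h y - h z - γ⁻¹ * ⟪w - z, y - z⟫) (‖y - z‖ ^ 2 / (2 * γ)) ?_
  · linarith
  intro t ht0 ht1
  have h1 := hz (z + t • (y - z))
  have h2 := hh.2 (Set.mem_univ z) (Set.mem_univ y) (sub_nonneg.2 ht1) ht0.le (by ring)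
  have e : (1 - t) • z + t • y = z + t • (y - z) := by module
  have e2 : w - (z + t • (y - z)) = (w - z) + (-t) • (y - z) := by module
  rw [e] at h2
  rw [e2, expand_aux] at h1
  simp only [smul_eq_mul] at h2
  have e3 : (‖w - z‖ ^ 2 + 2 * -t * ⟪w - z, y - z⟫ + (-t) ^ 2 * ‖y - z‖ ^ 2) / (2 * γ)
      = ‖w - z‖ ^ 2 / (2 * γ) - t * (γ⁻¹ * ⟪w - z, y - z⟫) + t ^ 2 * (‖y - z‖ ^ 2 / (2 * γ)) := by
    field_simp
    ring
  rw [e3] at h1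
  linarith

/-- **Dual part of the key inequality** for one step of the adaptive three
operator splitting: `h*(u⁺)` is finite and the dual suboptimality bound holds
(real values of `h*` are taken via `EReal.toReal`, which is faithful under the
finiteness hypotheses). -/
theorem dual_part_key_inequality {p : ℕ}
    (h : EuclideanSpace ℝ (Fin p) → ℝ)
    (hh : ConvexOn ℝ Set.univ h)
    (μ_h : ℝ) (hμh : 0 ≤ μ_h)
    (hconjsc : ConvexOn ℝ {v : EuclideanSpace ℝ (Fin p) | fenchel h v < ⊤}
      (fun v => (fenchel h v).toReal - μ_h / 2 * ‖v‖ ^ 2))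
    (γ : ℝ) (hγ : 0 < γ) (xp u zp up : EuclideanSpace ℝ (Fin p))
    (hzp : IsProx h γ (xp + γ • u) zp)
    (hup : up = u + γ⁻¹ • (xp - zp)) :
    fenchel h up < ⊤ ∧
      ∀ u' : EuclideanSpace ℝ (Fin p), fenchel h u' < ⊤ →
        (fenchel h up).toReal - (fenchel h u').toReal + ⟪xp, u' - up⟫ ≤
          γ / 2 * ‖u - u'‖ ^ 2 - 1 / (2 * γ) * ‖zp - xp‖ ^ 2 -
            (γ + μ_h) / 2 * ‖up - u'‖ ^ 2 := by
  have hsub : ∀ y, h zp + ⟪up, y - zp⟫ ≤ h y := by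
    intro y
    have := prox_subgrad h hh γ hγ _ _ y hzp
    have e : up = γ⁻¹ • (xp + γ • u - zp) := by
      rw [hup, smul_sub, smul_sub, smul_add, smul_smul, inv_mul_cancel₀ hγ.ne', one_smul]
      abel
    rwa [e, real_inner_smul_left]
  have hle : ∀ v, ((⟪zp, v⟫ - h zp : ℝ) : EReal) ≤ fenchel h v := fun v =>
    le_iSup (fun x => ((⟪x, v⟫ - h x : ℝ) : EReal)) zp
  have hval : fenchel h up = ((⟪zp, up⟫ - h zp : ℝ) : EReal) := by
    refine le_antisymm (iSup_le fun x => ?_) (hle up)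
    have := hsub x
    rw [inner_sub_right, real_inner_comm, real_inner_comm zp up] at this
    exact EReal.coe_le_coe_iff.2 (by linarith)
  have hleR : ∀ v, fenchel h v < ⊤ → ⟪zp, v⟫ - h zp ≤ (fenchel h v).toReal := by
    intro v hv
    have := EReal.toReal_le_toReal (hle v) (EReal.coe_ne_bot _) hv.ne
    rwa [EReal.toReal_coe] at this
  have hfin : fenchel h up < ⊤ := by rw [hval]; exact EReal.coe_lt_top _
  refine ⟨hfin, fun u' hu' => ?_⟩
  have hvR : (fenchel h up).toReal = ⟪zp, up⟫ - h zp := by rw [hval, EReal.toReal_coe]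
  have key := limit_aux ((fenchel h u').toReal - (fenchel h up).toReal
    - μ_h / 2 * ‖u' - up‖ ^ 2 - ⟪zp, u' - up⟫) (μ_h / 2 * ‖u' - up‖ ^ 2) ?_
  · have e1 : xp = zp + γ • (up - u) := by
      rw [hup, add_sub_cancel_left, smul_smul, mul_inv_cancel₀ hγ.ne', one_smul]
      abel
    have e2 : ‖zp - xp‖ ^ 2 = γ ^ 2 * ‖up - u‖ ^ 2 := by
      rw [norm_sub_rev, e1, add_sub_cancel_left, norm_smul, mul_pow, Real.norm_eq_abs, sq_abs]
    have e3 : ‖u - u'‖ ^ 2 = ‖up - u‖ ^ 2 + 2 * ⟪up - u, u' - up⟫ + ‖u' - up‖ ^ 2 := by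
      rw [norm_sub_rev, ← norm_add_sq_real]
      congr 2
      abel
    have e4 : ⟪xp, u' - up⟫ = ⟪zp, u' - up⟫ + γ * ⟪up - u, u' - up⟫ := by
      conv_lhs => rw [e1]
      rw [inner_add_left, real_inner_smul_left]
    have e5 : 1 / (2 * γ) * (γ ^ 2 * ‖up - u‖ ^ 2) = γ / 2 * ‖up - u‖ ^ 2 := by
      field_simp
    rw [e2, e3, e4, e5, norm_sub_rev up u']
    linarith
  intro t ht0 ht1
  have hm := hconjsc.1 (show up ∈ {v | fenchel h v < ⊤} from hfin) hu' (sub_nonneg.2 ht1) ht0.le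
    (by ring)
  have h2 := hconjsc.2 (show up ∈ {v | fenchel h v < ⊤} from hfin) hu' (sub_nonneg.2 ht1) ht0.le
    (by ring)
  have e : (1 - t) • up + t • u' = up + t • (u' - up) := by module
  rw [e] at hm h2
  have h3 := hleR _ hm
  have e6 := expand_aux up (u' - up) 1
  rw [one_smul, add_sub_cancel] at e6
  simp only [smul_eq_mul] at h2
  rw [expand_aux, e6] at h2
  rw [inner_add_right, real_inner_smul_right] at h3
  linarith
end
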